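/- arXiv:2601.21710 — 2 statements merged into one kernel-verified Lean document; each statement's English description precedes it below -/
import Mathlib

section
/- Let c ∈ ℝ, let (p_n) be a sequence in [0,1] with n·p_n − log n → c, and let (q_n) be any sequence in [0,1]. Then the sum over k from 2 to ⌈n/2⌉ of the probabilities P(G ∈ F_k^n), where G is drawn from the random digraph model G(n, p_n, q_n), tends to 0 as n → ∞; consequently P(G ∈ Γ^n) − P(G ∈ F_1^n) → 0. -/
open Finset Filter

/-- A matching in the bipartite representation of a digraph on `Fin n`:
a set of edges no two of which share a left endpoint or share a right endpoint. -/
def IsMatching (n : ℕ) (M : Finset (Fin n × Fin n)) : Prop :=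
  ∀ e ∈ M, ∀ f ∈ M, (e.1 = f.1 ∨ e.2 = f.2) → e = f

/-- `M` is a maximum matching of the bipartite representation of the digraph
with edge set `E`. -/
def IsMaxMatching (n : ℕ) (E M : Finset (Fin n × Fin n)) : Prop :=
  M ⊆ E ∧ IsMatching n M ∧ ∀ M' ⊆ E, IsMatching n M' → M'.card ≤ M.card

/-- The digraph `(V, M)` is a disjoint union of directed cycles and isolated
vertices: `M` is the graph of a permutation restricted to an invariant set `S`,
all vertices outside `S` being isolated. -/
def CyclesAndIsolated (n : ℕ) (M : Finset (Fin n × Fin n)) : Prop :=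
  ∃ σ : Equiv.Perm (Fin n), ∃ S : Finset (Fin n),
    (∀ u ∈ S, σ u ∈ S) ∧ M = S.image fun u => (u, σ u)

/-- A digraph is structurally diagonalizable if its bipartite representation has a
maximum matching `M` such that `(V, M)` is a disjoint union of directed cycles
and isolated vertices. -/
def StructurallyDiagonalizable (n : ℕ) (E : Finset (Fin n × Fin n)) : Prop :=
  ∃ M, IsMaxMatching n E M ∧ CyclesAndIsolated n M

/-- A Hamiltonian decomposition: a spanning subgraph that is a disjoint union of
directed cycles covering all `n` vertices, i.e. the functional graph of a
permutation contained in `E`. -/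
def HasHamiltonianDecomposition (n : ℕ) (E : Finset (Fin n × Fin n)) : Prop :=
  ∃ σ : Equiv.Perm (Fin n), ∀ u, (u, σ u) ∈ E

/-- A consistent matching of the bipartite representation of `E`: a matching whose
set of left endpoints equals its set of right endpoints. -/
def IsConsistentMatching (n : ℕ) (E M : Finset (Fin n × Fin n)) : Prop :=
  M ⊆ E ∧ IsMatching n M ∧ M.image Prod.fst = M.image Prod.snd

/-- Neighborhood, on the right side, of a set `I` of left vertices of `B(G)`. -/
def leftNbhd (n : ℕ) (E : Finset (Fin n × Fin n)) (I : Finset (Fin n)) :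
    Finset (Fin n) :=
  Finset.univ.filter fun v => ∃ u ∈ I, (u, v) ∈ E

/-- Neighborhood, on the left side, of a set `I` of right vertices of `B(G)`. -/
def rightNbhd (n : ℕ) (E : Finset (Fin n × Fin n)) (I : Finset (Fin n)) :
    Finset (Fin n) :=
  Finset.univ.filter fun u => ∃ v ∈ I, (u, v) ∈ E

/-- Membership in `F_k^n`: (1) some subset `I` of one side of `B(G)` has `|I| = k`
and `|N(I)| = k - 1`; (2) no subset `J` of either side with `|J| < k` satisfies
`|N(J)| = |J| - 1`. -/
def memF (n k : ℕ) (E : Finset (Fin n × Fin n)) : Prop :=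
  (∃ I : Finset (Fin n), I.card = k ∧
      ((leftNbhd n E I).card + 1 = k ∨ (rightNbhd n E I).card + 1 = k)) ∧
  ∀ J : Finset (Fin n), J.card < k →
      (leftNbhd n E J).card + 1 ≠ J.card ∧ (rightNbhd n E J).card + 1 ≠ J.card

/-- Membership in `L_k^n`: the bipartite representation of `E` admits a maximum
matching of size `n - k` that decomposes the digraph into disjoint cycles and
isolated vertices. -/
def memL (n k : ℕ) (E : Finset (Fin n × Fin n)) : Prop :=
  ∃ M, IsMaxMatching n E M ∧ M.card = n - k ∧ CyclesAndIsolated n M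

/-- The probability, under the random digraph model `G(n, p, q)` (each non-loop
edge present independently with probability `p`, each self-loop with
probability `q`), that the sampled digraph lies in the set `A`. -/
noncomputable def digraphProb (n : ℕ) (p q : ℝ)
    (A : Set (Finset (Fin n × Fin n))) : ℝ :=
  ∑ E : Finset (Fin n × Fin n),
    Set.indicator A (fun E =>
      (∏ e ∈ E, if e.1 = e.2 then q else p) *
      ∏ e ∈ Finset.univ \ E, if e.1 = e.2 then 1 - q else 1 - p) E

/-- The probability of a single digraph with edge set `E`. -/
noncomputable def digraphWeight (n : ℕ) (p q : ℝ) (E : Finset (Fin n × Fin n)) : ℝ :=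
  (∏ e ∈ E, if e.1 = e.2 then q else p) *
    ∏ e ∈ Finset.univ \ E, if e.1 = e.2 then 1 - q else 1 - p

lemma digraphWeight_nonneg {n : ℕ} {p q : ℝ} (hp : p ∈ Set.Icc (0 : ℝ) 1)
    (hq : q ∈ Set.Icc (0 : ℝ) 1) (E : Finset (Fin n × Fin n)) :
    0 ≤ digraphWeight n p q E := by
  obtain ⟨hp0, hp1⟩ := hp
  obtain ⟨hq0, hq1⟩ := hq
  refine mul_nonneg (prod_nonneg fun e _ => ?_) (prod_nonneg fun e _ => ?_) <;>
    split_ifs <;> linarith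

lemma digraphProb_eq_sum_indicator (n : ℕ) (p q : ℝ) (A : Set (Finset (Fin n × Fin n))) :
    digraphProb n p q A = ∑ E, A.indicator (digraphWeight n p q) E := rfl

lemma digraphProb_nonneg {n : ℕ} {p q : ℝ} (hp : p ∈ Set.Icc (0 : ℝ) 1)
    (hq : q ∈ Set.Icc (0 : ℝ) 1) (A : Set (Finset (Fin n × Fin n))) :
    0 ≤ digraphProb n p q A :=
  sum_nonneg fun E _ => Set.indicator_nonneg (fun E _ => digraphWeight_nonneg hp hq E) E

lemma digraphProb_mono {n : ℕ} {p q : ℝ} (hp : p ∈ Set.Icc (0 : ℝ) 1)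
    (hq : q ∈ Set.Icc (0 : ℝ) 1) {A B : Set (Finset (Fin n × Fin n))} (h : A ⊆ B) :
    digraphProb n p q A ≤ digraphProb n p q B :=
  sum_le_sum fun E _ =>
    Set.indicator_le_indicator_of_subset h (fun E => digraphWeight_nonneg hp hq E) E

lemma digraphProb_union_le {n : ℕ} {p q : ℝ} (hp : p ∈ Set.Icc (0 : ℝ) 1)
    (hq : q ∈ Set.Icc (0 : ℝ) 1) (A B : Set (Finset (Fin n × Fin n))) :
    digraphProb n p q (A ∪ B) ≤ digraphProb n p q A + digraphProb n p q B := by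
  simp only [digraphProb_eq_sum_indicator]
  rw [← sum_add_distrib]
  refine sum_le_sum fun E _ => ?_
  have hw := digraphWeight_nonneg hp hq E
  by_cases hA : E ∈ A <;> by_cases hB : E ∈ B <;> simp [hA, hB, hw]

lemma digraphProb_le_sum {n : ℕ} {p q : ℝ} (hp : p ∈ Set.Icc (0 : ℝ) 1)
    (hq : q ∈ Set.Icc (0 : ℝ) 1) {ι : Type*} (s : Finset ι)
    {A : Set (Finset (Fin n × Fin n))} {B : ι → Set (Finset (Fin n × Fin n))}
    (h : ∀ E ∈ A, ∃ i ∈ s, E ∈ B i) :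
    digraphProb n p q A ≤ ∑ i ∈ s, digraphProb n p q (B i) := by
  simp only [digraphProb_eq_sum_indicator]
  rw [sum_comm]
  refine sum_le_sum fun E _ => ?_
  have hnn : ∀ i ∈ s, 0 ≤ (B i).indicator (digraphWeight n p q) E := fun i _ =>
    Set.indicator_nonneg (fun E _ => digraphWeight_nonneg hp hq E) E
  by_cases hA : E ∈ A
  · obtain ⟨i, hi, hEi⟩ := h E hA
    calc A.indicator (digraphWeight n p q) E = (B i).indicator (digraphWeight n p q) E := by
          simp [hA, hEi]
      _ ≤ _ := single_le_sum hnn hi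
  · simpa [hA] using sum_nonneg hnn

/-- Reversing all edges preserves the random digraph model. -/
lemma digraphProb_preimage_swap (n : ℕ) (p q : ℝ) (A : Set (Finset (Fin n × Fin n))) :
    digraphProb n p q {E | E.map (Equiv.prodComm _ _).toEmbedding ∈ A} =
      digraphProb n p q A := by
  simp only [digraphProb_eq_sum_indicator]
  refine Fintype.sum_equiv (Equiv.finsetCongr (Equiv.prodComm (Fin n) (Fin n))) _ _ fun E => ?_
  have hw : digraphWeight n p q (E.map (Equiv.prodComm _ _).toEmbedding) =
      digraphWeight n p q E := by
    have hc : (Finset.univ : Finset (Fin n × Fin n)) \ E.map (Equiv.prodComm _ _).toEmbedding =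
        (Finset.univ \ E).map (Equiv.prodComm _ _).toEmbedding := by
      ext ⟨a, b⟩
      simp
    unfold digraphWeight
    rw [hc, prod_map, prod_map]
    simp [eq_comm]
  rw [Equiv.finsetCongr_apply]
  by_cases hE : E.map (Equiv.prodComm _ _).toEmbedding ∈ A
  · rw [Set.indicator_of_mem hE, Set.indicator_of_mem (by exact hE), hw]
  · rw [Set.indicator_of_notMem hE, Set.indicator_of_notMem (by exact hE)]

/-- The probability that all edges of `R` are present and all edges of `S` are absent. -/
lemma digraphProb_subset_disjoint (n : ℕ) (p q : ℝ) {R S : Finset (Fin n × Fin n)}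
    (hRS : Disjoint R S) (hR : ∀ e ∈ R, e.1 ≠ e.2) (hS : ∀ e ∈ S, e.1 ≠ e.2) :
    digraphProb n p q {E | R ⊆ E ∧ Disjoint S E} = p ^ R.card * (1 - p) ^ S.card := by
  classical
  set f : Fin n × Fin n → ℝ := fun e => if e ∈ S then 0 else if e.1 = e.2 then q else p with hf
  set g : Fin n × Fin n → ℝ :=
    fun e => if e ∈ R then 0 else if e.1 = e.2 then 1 - q else 1 - p with hg
  have key : digraphProb n p q {E | R ⊆ E ∧ Disjoint S E} = ∏ e, (f e + g e) := by
    rw [prod_add, powerset_univ, digraphProb_eq_sum_indicator]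
    refine sum_congr rfl fun E _ => ?_
    by_cases hE : R ⊆ E ∧ Disjoint S E
    · rw [Set.indicator_of_mem (by exact hE)]
      unfold digraphWeight
      congr 1
      · refine prod_congr rfl fun e he => ?_
        simp [hf, disjoint_right.1 hE.2 he]
      · refine prod_congr rfl fun e he => ?_
        have : e ∉ R := fun h => (mem_sdiff.1 he).2 (hE.1 h)
        simp [hg, this]
    · rw [Set.indicator_of_notMem (by exact hE)]
      symm
      rw [not_and_or] at hE
      rcases hE with hE | hE
      · obtain ⟨e, heR, heE⟩ := not_subset.1 hE
        rw [prod_eq_zero (s := Finset.univ \ E) (i := e) (by simp [heE]) (by simp [hg, heR]),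
          mul_zero]
      · obtain ⟨e, heS, heE⟩ := not_disjoint_iff.1 hE
        rw [prod_eq_zero (s := E) (i := e) heE (by simp [hf, heS]), zero_mul]
  have hfg : ∀ e, f e + g e = (if e ∈ R then p else 1) * (if e ∈ S then 1 - p else 1) := by
    intro e
    by_cases heR : e ∈ R
    · simp [hf, hg, heR, disjoint_left.1 hRS heR, hR e heR]
    · by_cases heS : e ∈ S
      · simp [hf, hg, heR, heS, hS e heS]
      · by_cases h : e.1 = e.2 <;> simp [hf, hg, heR, heS, h]
  rw [key, prod_congr rfl fun e _ => hfg e, prod_mul_distrib, prod_ite_mem, prod_ite_mem]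
  simp

lemma leftNbhd_mono {n : ℕ} {E : Finset (Fin n × Fin n)} {I J : Finset (Fin n)} (h : I ⊆ J) :
    leftNbhd n E I ⊆ leftNbhd n E J := by
  intro v hv
  simp only [leftNbhd, mem_filter, mem_univ, true_and] at hv ⊢
  obtain ⟨u, hu, huv⟩ := hv
  exact ⟨u, h hu, huv⟩

lemma rightNbhd_eq_leftNbhd_swap (n : ℕ) (E : Finset (Fin n × Fin n)) (I : Finset (Fin n)) :
    rightNbhd n E I = leftNbhd n (E.map (Equiv.prodComm _ _).toEmbedding) I := by
  ext u
  simp [rightNbhd, leftNbhd]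

/-- A set violating Hall's condition contains a set of deficiency exactly one. -/
lemma exists_subset_card_leftNbhd_add_one {n : ℕ} {E : Finset (Fin n × Fin n)}
    (I : Finset (Fin n)) (h : (leftNbhd n E I).card < I.card) :
    ∃ J ⊆ I, (leftNbhd n E J).card + 1 = J.card := by
  induction I using Finset.induction_on with
  | empty => simp at h
  | insert a I ha ih =>
    by_cases hI : (leftNbhd n E I).card < I.card
    · obtain ⟨J, hJ, hJc⟩ := ih hI
      exact ⟨J, hJ.trans (subset_insert a I), hJc⟩
    · refine ⟨insert a I, Subset.rfl, ?_⟩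
      have := card_le_card (leftNbhd_mono (E := E) (subset_insert a I))
      rw [card_insert_of_notMem ha] at h ⊢
      omega

/-- There is a set of left vertices of size `k` and deficiency one in the bipartite representation,
and no smaller such set. -/
def IsLeftObstruction (n k : ℕ) (E : Finset (Fin n × Fin n)) : Prop :=
  (∃ I : Finset (Fin n), I.card = k ∧ (leftNbhd n E I).card + 1 = k) ∧
    ∀ J : Finset (Fin n), J.card < k → (leftNbhd n E J).card + 1 ≠ J.card

lemma memF.isLeftObstruction {n k : ℕ} {E : Finset (Fin n × Fin n)} (h : memF n k E) :
    IsLeftObstruction n k E ∨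
      IsLeftObstruction n k (E.map (Equiv.prodComm _ _).toEmbedding) := by
  obtain ⟨⟨I, hI, h1 | h1⟩, h2⟩ := h
  · exact Or.inl ⟨⟨I, hI, h1⟩, fun J hJ => (h2 J hJ).1⟩
  · simp only [rightNbhd_eq_leftNbhd_swap] at h1 h2
    exact Or.inr ⟨⟨I, hI, h1⟩, fun J hJ => (h2 J hJ).2⟩

/-- In a minimal set of deficiency one with at least two vertices, every neighbour is
adjacent to at least two vertices of the set. -/
lemma two_le_card_filter_of_minimal {n : ℕ} {E : Finset (Fin n × Fin n)} {I : Finset (Fin n)}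
    (hI : (leftNbhd n E I).card + 1 = I.card)
    (hmin : ∀ J : Finset (Fin n), J.card < I.card → (leftNbhd n E J).card + 1 ≠ J.card)
    {v : Fin n} (hv : v ∈ leftNbhd n E I) : 2 ≤ (I.filter fun u => (u, v) ∈ E).card := by
  by_contra! hlt
  obtain ⟨u, hu, huv⟩ : ∃ u ∈ I, (u, v) ∈ E := by simpa [leftNbhd] using hv
  have hsub : leftNbhd n E (I.erase u) ⊆ (leftNbhd n E I).erase v := by
    intro w hw
    refine mem_erase.2 ⟨?_, leftNbhd_mono (erase_subset u I) hw⟩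
    rintro rfl
    obtain ⟨u', hu', huw⟩ : ∃ u' ∈ I.erase u, (u', w) ∈ E := by
      simpa only [leftNbhd, mem_filter, mem_univ, true_and] using hw
    rw [mem_erase] at hu'
    exact hu'.1 (card_le_one.1 (Nat.lt_succ_iff.1 hlt) u' (by simp [hu'.2, huw]) u
      (by simp [hu, huv]))
  have h1 := card_le_card hsub
  have h2 := card_erase_of_mem hv
  have h3 := card_erase_of_mem hu
  have h4 : 0 < (leftNbhd n E I).card := card_pos.2 ⟨v, hv⟩
  obtain ⟨J, hJ, hJc⟩ := exists_subset_card_leftNbhd_add_one (E := E) (I.erase u) (by omega)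
  exact hmin J (by have := card_le_card hJ; omega) hJc

/-- The non-loop pairs from `I` to `W`. -/
def offDiagProd {n : ℕ} (I W : Finset (Fin n)) : Finset (Fin n × Fin n) :=
  (I ×ˢ W).filter fun e => e.1 ≠ e.2

lemma card_offDiagProd_le {n : ℕ} (I W : Finset (Fin n)) :
    (offDiagProd I W).card ≤ I.card * W.card :=
  (card_filter_le _ _).trans (card_product _ _).le

lemma mul_card_le_card_offDiagProd_add {n : ℕ} (I W : Finset (Fin n)) :
    I.card * W.card ≤ (offDiagProd I W).card + I.card := by
  rw [← card_product, ← card_filter_add_card_filter_not (s := I ×ˢ W) fun e => e.1 ≠ e.2]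
  refine Nat.add_le_add_left (card_le_card_of_injOn Prod.fst (fun e he => ?_) ?_) _
  · exact (mem_product.1 (mem_filter.1 he).1).1
  · rintro ⟨a, b⟩ h ⟨a', b'⟩ h' haa
    simp_all

/-- A left obstruction of size `k` has at least `2 (k - 1) - |I ∩ N(I)|` non-loop edges between
`I` and `N(I)`, and none leaving `I` elsewhere. -/
lemma IsLeftObstruction.exists_edges {n k : ℕ} {E : Finset (Fin n × Fin n)}
    (h : IsLeftObstruction n k E) :
    ∃ I ∈ powersetCard k (univ : Finset (Fin n)),
      ∃ W ∈ powersetCard (k - 1) (univ : Finset (Fin n)),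
        ∃ R ∈ powersetCard (2 * (k - 1) - (W ∩ I).card) (offDiagProd I W),
          R ⊆ E ∧ Disjoint (offDiagProd I Wᶜ) E := by
  obtain ⟨⟨I, hI, hN⟩, hmin⟩ := h
  subst hI
  set W := leftNbhd n E I with hW
  have hcount : 2 * (I.card - 1) - (W ∩ I).card ≤ (offDiagProd I W ∩ E).card := by
    have hmaps : ∀ e ∈ offDiagProd I W ∩ E, e.2 ∈ W := by
      intro e he
      simp only [offDiagProd, mem_inter, mem_filter, mem_product] at he
      exact he.1.1.2
    rw [card_eq_sum_card_fiberwise hmaps]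
    have hterm : ∀ v ∈ W, 2 ≤ ((offDiagProd I W ∩ E).filter fun e => e.2 = v).card +
        if v ∈ I then 1 else 0 := by
      intro v hv
      have h2 := two_le_card_filter_of_minimal hN hmin hv
      have hle : ((I.filter fun u => (u, v) ∈ E).erase v).card ≤
          ((offDiagProd I W ∩ E).filter fun e => e.2 = v).card := by
        refine card_le_card_of_injOn (fun u => (u, v)) (fun u hu => ?_) ?_
        · simp_all [offDiagProd]
        · intro a _ b _ hab
          exact (Prod.ext_iff.1 hab).1
      split_ifs with hvI
      · have := pred_card_le_card_erase (s := I.filter fun u => (u, v) ∈ E) (a := v)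
        omega
      · rw [erase_eq_of_notMem (by simp [hvI])] at hle
        omega
    have hsum := sum_le_sum hterm
    rw [sum_add_distrib, sum_const, sum_boole, filter_mem_eq_inter] at hsum
    simp only [smul_eq_mul, Nat.cast_id] at hsum
    omega
  obtain ⟨R, hR, hRc⟩ := exists_subset_card_eq hcount
  refine ⟨I, by simp, W, by simp [mem_powersetCard]; omega, R,
    mem_powersetCard.2 ⟨hR.trans inter_subset_left, hRc⟩, hR.trans inter_subset_right, ?_⟩
  rw [disjoint_left]
  rintro ⟨u, v⟩ huv hE
  simp only [offDiagProd, mem_filter, mem_product, mem_compl] at huv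
  exact huv.1.2 (mem_filter.2 ⟨mem_univ v, u, huv.1.1, hE⟩)

lemma exists_card_leftNbhd_lt_of_not_hasHamiltonianDecomposition {n : ℕ}
    {E : Finset (Fin n × Fin n)} (h : ¬ HasHamiltonianDecomposition n E) :
    ∃ I : Finset (Fin n), (leftNbhd n E I).card < I.card := by
  by_contra! hall
  refine h ?_
  obtain ⟨f, hf, hfE⟩ := (Finset.all_card_le_biUnion_card_iff_exists_injective
    (fun u : Fin n => univ.filter fun v => (u, v) ∈ E)).1 fun s => by
      have hs : (s.biUnion fun u => univ.filter fun v => (u, v) ∈ E) = leftNbhd n E s := by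
        ext v
        simp [leftNbhd]
      exact hs ▸ hall s
  exact ⟨Equiv.ofBijective f (Finite.injective_iff_bijective.1 hf), fun u => by simpa using hfE u⟩

/-- A digraph without Hamiltonian decomposition lies in some `F_k^n` with `1 ≤ k ≤ ⌈n/2⌉`. -/
lemma exists_memF_of_not_hasHamiltonianDecomposition {n : ℕ} {E : Finset (Fin n × Fin n)}
    (h : ¬ HasHamiltonianDecomposition n E) : ∃ k ∈ Icc 1 ((n + 1) / 2), memF n k E := by
  classical
  have hex : ∃ k, ∃ J : Finset (Fin n), J.card = k ∧ k ≤ (n + 1) / 2 ∧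
      ((leftNbhd n E J).card + 1 = k ∨ (rightNbhd n E J).card + 1 = k) := by
    obtain ⟨I₀, hI₀⟩ := exists_card_leftNbhd_lt_of_not_hasHamiltonianDecomposition h
    obtain ⟨I, -, hI⟩ := exists_subset_card_leftNbhd_add_one I₀ hI₀
    by_cases hle : I.card ≤ (n + 1) / 2
    · exact ⟨_, I, rfl, hle, Or.inl hI⟩
    · have hsub : rightNbhd n E (leftNbhd n E I)ᶜ ⊆ Iᶜ := by
        intro u hu
        simp only [rightNbhd, leftNbhd, mem_filter, mem_univ, true_and, mem_compl] at hu ⊢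
        obtain ⟨v, hv, huv⟩ := hu
        exact fun huI => hv ⟨u, huI, huv⟩
      have h1 := card_le_card hsub
      have h2 := card_compl I
      have h3 := card_compl (leftNbhd n E I)
      have h4 := card_le_univ I
      simp only [Fintype.card_fin] at h2 h3 h4
      simp only [rightNbhd_eq_leftNbhd_swap] at h1 ⊢
      obtain ⟨J, hJ, hJc⟩ := exists_subset_card_leftNbhd_add_one _
        (show (leftNbhd n (E.map (Equiv.prodComm _ _).toEmbedding) (leftNbhd n E I)ᶜ).card <
          (leftNbhd n E I)ᶜ.card by omega)
      have h5 := card_le_card hJ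
      exact ⟨_, J, rfl, by omega, Or.inr hJc⟩
  obtain ⟨J, hJ, hle, hdef⟩ := Nat.find_spec hex
  refine ⟨Nat.find hex, mem_Icc.2 ⟨by omega, hle⟩, ⟨J, hJ, hdef⟩, fun J' hJ' => ?_⟩
  have hmin := Nat.find_min hex hJ'
  push Not at hmin
  exact hmin J' rfl (hJ'.le.trans hle)

lemma memF_one.not_hasHamiltonianDecomposition {n : ℕ} {E : Finset (Fin n × Fin n)}
    (h : memF n 1 E) : ¬ HasHamiltonianDecomposition n E := by
  rintro ⟨σ, hσ⟩
  obtain ⟨⟨I, hI, hdef⟩, -⟩ := h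
  obtain ⟨u, rfl⟩ := card_eq_one.1 hI
  rcases hdef with hdef | hdef
  · have : σ u ∈ leftNbhd n E {u} := by simp [leftNbhd, hσ u]
    have := card_pos.2 ⟨_, this⟩
    omega
  · have : σ.symm u ∈ rightNbhd n E {u} := by simpa [rightNbhd] using hσ (σ.symm u)
    have := card_pos.2 ⟨_, this⟩
    omega

lemma one_sub_pow_le_exp {p : ℝ} (hp : p ∈ Set.Icc (0 : ℝ) 1) {n k m : ℕ} (hkn : k ≤ n)
    (hm : k * (n - k) ≤ m) : (1 - p) ^ m ≤ Real.exp (-(p * k * (n - k))) := by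
  have h0 : 0 ≤ 1 - p := by linarith [hp.2]
  calc (1 - p) ^ m ≤ (1 - p) ^ (k * (n - k)) := pow_le_pow_of_le_one h0 (by linarith [hp.1]) hm
    _ ≤ Real.exp (-p) ^ (k * (n - k)) := by
        gcongr
        linarith [Real.add_one_le_exp (-p)]
    _ = Real.exp (-(p * k * (n - k))) := by
        rw [← Real.exp_nat_mul, Nat.cast_mul, Nat.cast_sub hkn]
        ring_nf

lemma mul_sub_le_card_offDiagProd_compl {n k : ℕ} (hk : 1 ≤ k) (hkn : k ≤ n)
    {I W : Finset (Fin n)} (hI : I.card = k) (hW : W.card = k - 1) :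
    k * (n - k) ≤ (offDiagProd I Wᶜ).card := by
  have h := mul_card_le_card_offDiagProd_add I Wᶜ
  rw [card_compl, Fintype.card_fin, hI, hW, show n - (k - 1) = n - k + 1 by omega, mul_add] at h
  omega

lemma offDiagProd_disjoint_compl {n : ℕ} (I W : Finset (Fin n)) :
    Disjoint (offDiagProd I W) (offDiagProd I Wᶜ) := by
  rw [disjoint_left]
  intro e h h'
  simp only [offDiagProd, mem_filter, mem_product, mem_compl] at h h'
  exact h'.1.2 h.1.2

lemma fst_ne_snd_of_mem_offDiagProd {n : ℕ} {I W : Finset (Fin n)} {e : Fin n × Fin n}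
    (he : e ∈ offDiagProd I W) : e.1 ≠ e.2 := (mem_filter.1 he).2

/-- Union bound for left obstructions, discarding the edges inside `I × N(I)`. -/
lemma digraphProb_isLeftObstruction_le_choose {n k : ℕ} {p q : ℝ} (hp : p ∈ Set.Icc (0 : ℝ) 1)
    (hq : q ∈ Set.Icc (0 : ℝ) 1) (hk : 1 ≤ k) (hkn : k ≤ n) :
    digraphProb n p q {E | IsLeftObstruction n k E} ≤
      n.choose k * n.choose (k - 1) * Real.exp (-(p * k * (n - k))) := by
  have h : ∀ E ∈ {E | IsLeftObstruction n k E},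
      ∃ i ∈ powersetCard k (univ : Finset (Fin n)) ×ˢ powersetCard (k - 1) (univ : Finset (Fin n)),
        E ∈ {E | (∅ : Finset (Fin n × Fin n)) ⊆ E ∧ Disjoint (offDiagProd i.1 i.2ᶜ) E} := by
    intro E hE
    obtain ⟨I, hI, W, hW, R, -, -, hd⟩ := IsLeftObstruction.exists_edges hE
    exact ⟨(I, W), mem_product.2 ⟨hI, hW⟩, empty_subset E, hd⟩
  refine (digraphProb_le_sum hp hq _ h).trans ((sum_le_card_nsmul _ _
    (Real.exp (-(p * k * (n - k)))) fun i hi => ?_).trans_eq ?_)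
  · simp only [mem_product, mem_powersetCard] at hi
    rw [digraphProb_subset_disjoint n p q (disjoint_empty_left _) (by simp)
      fun e he => fst_ne_snd_of_mem_offDiagProd he]
    simpa using one_sub_pow_le_exp hp hkn
      (mul_sub_le_card_offDiagProd_compl hk hkn hi.1.2 hi.2.2)
  · simp [card_product]

/-- Union bound for left obstructions over `I`, `N(I)` and a set of edges between them. -/
lemma digraphProb_isLeftObstruction_le_sum {n k : ℕ} {p q : ℝ} (hp : p ∈ Set.Icc (0 : ℝ) 1)
    (hq : q ∈ Set.Icc (0 : ℝ) 1) (hk : 1 ≤ k) (hkn : k ≤ n) :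
    digraphProb n p q {E | IsLeftObstruction n k E} ≤
      ∑ I ∈ powersetCard k (univ : Finset (Fin n)),
        ∑ W ∈ powersetCard (k - 1) (univ : Finset (Fin n)),
          ((k ^ 2).choose (2 * (k - 1) - (W ∩ I).card) *
            p ^ (2 * (k - 1) - (W ∩ I).card)) * Real.exp (-(p * k * (n - k))) := by
  refine (digraphProb_le_sum hp hq (powersetCard k (univ : Finset (Fin n)))
    (B := fun I => {E | ∃ W ∈ powersetCard (k - 1) (univ : Finset (Fin n)),
        ∃ R ∈ powersetCard (2 * (k - 1) - (W ∩ I).card) (offDiagProd I W),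
          R ⊆ E ∧ Disjoint (offDiagProd I Wᶜ) E})
    fun E hE => IsLeftObstruction.exists_edges hE).trans (sum_le_sum fun I hI => ?_)
  refine (digraphProb_le_sum hp hq (powersetCard (k - 1) (univ : Finset (Fin n)))
    (B := fun W => {E | ∃ R ∈ powersetCard (2 * (k - 1) - (W ∩ I).card) (offDiagProd I W),
          R ⊆ E ∧ Disjoint (offDiagProd I Wᶜ) E})
    fun E hE => hE).trans (sum_le_sum fun W hW => ?_)
  set r := 2 * (k - 1) - (W ∩ I).card
  refine (digraphProb_le_sum hp hq (powersetCard r (offDiagProd I W))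
    (B := fun R => {E | R ⊆ E ∧ Disjoint (offDiagProd I Wᶜ) E})
    fun E hE => hE).trans ?_
  have hIc := (mem_powersetCard.1 hI).2
  have hWc := (mem_powersetCard.1 hW).2
  have hp0 := hp.1
  refine (sum_le_card_nsmul _ _ (p ^ r * Real.exp (-(p * k * (n - k)))) fun R hR => ?_).trans ?_
  · rw [mem_powersetCard] at hR
    rw [digraphProb_subset_disjoint n p q
      (disjoint_of_subset_left hR.1 (offDiagProd_disjoint_compl I W))
      (fun e he => fst_ne_snd_of_mem_offDiagProd (hR.1 he))
      fun e he => fst_ne_snd_of_mem_offDiagProd he, hR.2]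
    gcongr
    exact one_sub_pow_le_exp hp hkn (mul_sub_le_card_offDiagProd_compl hk hkn hIc hWc)
  · rw [card_powersetCard, nsmul_eq_mul, ← mul_assoc]
    have hle : (offDiagProd I W).card ≤ k ^ 2 := by
      refine (card_offDiagProd_le I W).trans ?_
      rw [hIc, hWc, sq]
      exact Nat.mul_le_mul_left k (Nat.sub_le k 1)
    gcongr

lemma choose_mul_choose_mul_pow_le {n k j : ℕ} {p : ℝ} (hp : 0 ≤ p) (hnp : 1 ≤ n * p)
    (hj : j ≤ k - 1) :
    (n.choose j : ℝ) * ((k ^ 2).choose (k - 1 + j) * p ^ (k - 1 + j)) ≤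
      Real.exp k ^ 2 * (n * p * (k * p)) ^ (k - 1) := by
  set m := k - 1
  calc (n.choose j : ℝ) * ((k ^ 2).choose (m + j) * p ^ (m + j))
      ≤ (n : ℝ) ^ j / j.factorial *
          (((k ^ 2 : ℕ) : ℝ) ^ (m + j) / (m + j).factorial * p ^ (m + j)) := by
        gcongr
        · exact Nat.choose_le_pow_div j n
        · exact Nat.choose_le_pow_div (m + j) (k ^ 2)
    _ = ((k : ℝ) ^ j / j.factorial) * ((k : ℝ) ^ (m + j) / (m + j).factorial) *
          ((n * p) ^ j * (k * p) ^ m) := by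
        push_cast
        simp only [mul_pow, pow_add, ← pow_mul]
        ring
    _ ≤ Real.exp k * Real.exp k * ((n * p) ^ m * (k * p) ^ m) := by
        gcongr
        · exact Real.pow_div_factorial_le_exp _ (by positivity) _
        · exact Real.pow_div_factorial_le_exp _ (by positivity) _
    _ = Real.exp k ^ 2 * (n * p * (k * p)) ^ m := by
        rw [mul_pow (n * p)]
        ring

lemma sum_powersetCard_choose_mul_pow_le {n k : ℕ} {p : ℝ} (hp : 0 ≤ p) (hnp : 1 ≤ n * p)
    {I : Finset (Fin n)} (hI : I.card = k) :
    ∑ W ∈ powersetCard (k - 1) (univ : Finset (Fin n)),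
        ((k ^ 2).choose (2 * (k - 1) - (W ∩ I).card) : ℝ) * p ^ (2 * (k - 1) - (W ∩ I).card) ≤
      2 ^ k * (Real.exp k ^ 2 * (n * p * (k * p)) ^ (k - 1)) := by
  rw [← sum_fiberwise_of_maps_to (t := I.powerset) (g := fun W => W ∩ I)
    fun W _ => mem_powerset.2 inter_subset_right]
  have hcard : (2 : ℝ) ^ k = I.powerset.card := by simp [card_powerset, hI]
  rw [hcard, ← nsmul_eq_mul]
  refine sum_le_card_nsmul _ _ _ fun A hA => ?_
  by_cases hAk : A.card ≤ k - 1
  · set j := k - 1 - A.card with hj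
    have hr : 2 * (k - 1) - A.card = k - 1 + j := by omega
    have hfib : ((powersetCard (k - 1) (univ : Finset (Fin n))).filter
        fun W => W ∩ I = A).card ≤ n.choose j := by
      calc _ ≤ (powersetCard j (univ : Finset (Fin n))).card := by
            refine card_le_card_of_injOn (fun W => W \ I) (fun W hW => ?_) ?_
            · simp only [coe_filter, mem_powersetCard, Set.mem_ofPred_eq] at hW
              have := card_sdiff_add_card_inter W I
              rw [hW.2, hW.1.2] at this
              rw [mem_coe, mem_powersetCard]
              exact ⟨subset_univ _, Nat.eq_sub_of_add_eq this⟩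
            · intro W hW W' hW' h
              simp only [coe_filter, mem_powersetCard, Set.mem_ofPred_eq] at hW hW' h
              rw [← sdiff_union_inter W I, ← sdiff_union_inter W' I, h, hW.2, hW'.2]
        _ = n.choose j := by simp
    refine le_trans (sum_le_card_nsmul _ _
      (((k ^ 2).choose (k - 1 + j) : ℝ) * p ^ (k - 1 + j)) fun W hW => ?_)
      (le_trans ?_ (choose_mul_choose_mul_pow_le hp hnp (Nat.sub_le (k - 1) A.card)))
    · rw [(mem_filter.1 hW).2, hr]
    · rw [nsmul_eq_mul]
      gcongr
  · rw [sum_eq_zero fun W hW => ?_]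
    · positivity
    · have h := mem_filter.1 hW
      have h1 := (mem_powersetCard.1 h.1).2
      have h2 := card_le_card (inter_subset_left (s₁ := W) (s₂ := I))
      rw [h.2] at h2
      omega

lemma choose_le_exp_one_mul_pow {n k j : ℕ} {x : ℝ} (hj : j ≤ k) (hkn : k ≤ n) (hk : 1 ≤ k)
    (hx : n ≤ k * x) : (n.choose j : ℝ) ≤ (Real.exp 1 * x) ^ k := by
  have hn1 : (1 : ℝ) ≤ n := by exact_mod_cast hk.trans hkn
  have hk0 : (0 : ℝ) < k := by exact_mod_cast hk
  have hx0 : 0 ≤ x := by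
    by_contra! h
    nlinarith
  have hfac : (k.factorial : ℝ) ≤ n ^ (k - j) * j.factorial := by
    have h := Nat.factorial_mul_descFactorial (Nat.sub_le k j)
    rw [Nat.sub_sub_self hj] at h
    have h' : k.factorial ≤ n ^ (k - j) * j.factorial := by
      rw [← h, mul_comm]
      exact Nat.mul_le_mul_right _
        ((Nat.descFactorial_le_pow k _).trans (Nat.pow_le_pow_left hkn _))
    exact_mod_cast h'
  calc (n.choose j : ℝ) ≤ (n : ℝ) ^ j / j.factorial := Nat.choose_le_pow_div j n
    _ ≤ (n : ℝ) ^ k / k.factorial := by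
        rw [div_le_div_iff₀ (by positivity) (by positivity)]
        calc (n : ℝ) ^ j * k.factorial ≤ n ^ j * (n ^ (k - j) * j.factorial) := by gcongr
          _ = n ^ k * j.factorial := by rw [← mul_assoc, ← pow_add, Nat.add_sub_cancel' hj]
    _ ≤ (k * x) ^ k / k.factorial := by gcongr
    _ = (k : ℝ) ^ k / k.factorial * x ^ k := by ring
    _ ≤ Real.exp k * x ^ k := by
        gcongr
        exact Real.pow_div_factorial_le_exp _ hk0.le _
    _ = (Real.exp 1 * x) ^ k := by rw [mul_pow, ← Real.exp_nat_mul, mul_one]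

lemma digraphProb_isLeftObstruction_le_of_small {n k : ℕ} {p q B : ℝ}
    (hp : p ∈ Set.Icc (0 : ℝ) 1) (hq : q ∈ Set.Icc (0 : ℝ) 1) (hk : 2 ≤ k) (hkn : k ≤ n)
    (hnp : 1 ≤ n * p) (hkp : k * p ≤ 1) (hB : 1 ≤ B) (hnB : n * Real.exp (-(n * p)) ≤ B) :
    digraphProb n p q {E | IsLeftObstruction n k E} ≤
      ((2 * Real.exp 1 ^ 4 * B) ^ 2 * (n * p ^ 2)) ^ (k - 1) := by
  have hp0 := hp.1
  have hexp : Real.exp (-(p * k * (n - k))) ≤ Real.exp (-(n * p)) ^ k * Real.exp 1 ^ k := by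
    rw [← Real.exp_nat_mul, ← Real.exp_nat_mul, ← Real.exp_add, Real.exp_le_exp]
    nlinarith [mul_le_mul_of_nonneg_left hkp (Nat.cast_nonneg (α := ℝ) k)]
  have hek : Real.exp k = Real.exp 1 ^ k := by rw [← Real.exp_nat_mul, mul_one]
  have hchoose : (n.choose k : ℝ) * (k : ℝ) ^ (k - 1) ≤ n ^ k * Real.exp 1 ^ k := by
    have hk1 : (1 : ℝ) ≤ k := by exact_mod_cast (by omega : 1 ≤ k)
    calc (n.choose k : ℝ) * (k : ℝ) ^ (k - 1) ≤ (n : ℝ) ^ k / k.factorial * (k : ℝ) ^ k := by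
          gcongr
          · exact Nat.choose_le_pow_div k n
          · exact Nat.sub_le k 1
      _ = (n : ℝ) ^ k * ((k : ℝ) ^ k / k.factorial) := by ring
      _ ≤ (n : ℝ) ^ k * Real.exp 1 ^ k := by
          rw [← hek]
          gcongr
          exact Real.pow_div_factorial_le_exp _ (by positivity) _
  calc digraphProb n p q {E | IsLeftObstruction n k E}
      ≤ ∑ I ∈ powersetCard k (univ : Finset (Fin n)),
          2 ^ k * (Real.exp k ^ 2 * (n * p * (k * p)) ^ (k - 1)) *
            Real.exp (-(p * k * (n - k))) := by
        refine (digraphProb_isLeftObstruction_le_sum hp hq (by omega) hkn).trans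
          (sum_le_sum fun I hI => ?_)
        rw [← sum_mul]
        gcongr
        exact sum_powersetCard_choose_mul_pow_le hp0 hnp (mem_powersetCard.1 hI).2
    _ = (n.choose k * (k : ℝ) ^ (k - 1)) * 2 ^ k * Real.exp k ^ 2 * (n * p ^ 2) ^ (k - 1) *
          Real.exp (-(p * k * (n - k))) := by
        rw [sum_const, card_powersetCard, card_univ, Fintype.card_fin, nsmul_eq_mul,
          show (n * p * (k * p) : ℝ) = k * (n * p ^ 2) by ring, mul_pow (k : ℝ)]
        ring
    _ ≤ (n ^ k * Real.exp 1 ^ k) * 2 ^ k * Real.exp k ^ 2 * (n * p ^ 2) ^ (k - 1) *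
          (Real.exp (-(n * p)) ^ k * Real.exp 1 ^ k) := by gcongr
    _ = (2 * Real.exp 1 ^ 4 * (n * Real.exp (-(n * p)))) ^ k * (n * p ^ 2) ^ (k - 1) := by
        rw [hek]
        simp only [mul_pow]
        ring
    _ ≤ (2 * Real.exp 1 ^ 4 * B) ^ k * (n * p ^ 2) ^ (k - 1) := by gcongr
    _ ≤ (2 * Real.exp 1 ^ 4 * B) ^ (2 * (k - 1)) * (n * p ^ 2) ^ (k - 1) := by
        have h1 : 1 ≤ Real.exp 1 ^ 4 := one_le_pow₀ (Real.one_le_exp zero_le_one)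
        gcongr
        · nlinarith
        · omega
    _ = _ := by rw [pow_mul, ← mul_pow]

lemma digraphProb_isLeftObstruction_le_of_large {n k : ℕ} {p q : ℝ}
    (hp : p ∈ Set.Icc (0 : ℝ) 1) (hq : q ∈ Set.Icc (0 : ℝ) 1) (hk : 2 ≤ k)
    (hkn : k ≤ (n + 1) / 2) (hkp : 1 ≤ k * p) :
    digraphProb n p q {E | IsLeftObstruction n k E} ≤
      (Real.exp 1 ^ 2 * ((n * p) ^ 2 * Real.exp (-(n * p / 4)))) ^ k := by
  have hn : k ≤ n := by omega
  have hx : (n : ℝ) ≤ k * (n * p) := by nlinarith [Nat.cast_nonneg (α := ℝ) n]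
  have hp0 := hp.1
  have hexp : Real.exp (-(p * k * (n - k))) ≤ Real.exp (-(n * p / 4)) ^ k := by
    rw [← Real.exp_nat_mul, Real.exp_le_exp]
    have h4 : (4 * k : ℝ) ≤ 3 * n := by exact_mod_cast (by omega : 4 * k ≤ 3 * n)
    nlinarith [mul_nonneg hp0 (Nat.cast_nonneg (α := ℝ) k)]
  calc digraphProb n p q {E | IsLeftObstruction n k E}
      ≤ n.choose k * n.choose (k - 1) * Real.exp (-(p * k * (n - k))) :=
        digraphProb_isLeftObstruction_le_choose hp hq (by omega) hn
    _ ≤ (Real.exp 1 * (n * p)) ^ k * (Real.exp 1 * (n * p)) ^ k * Real.exp (-(n * p / 4)) ^ k := by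
        gcongr
        · exact choose_le_exp_one_mul_pow le_rfl hn (by omega) hx
        · exact choose_le_exp_one_mul_pow (Nat.sub_le k 1) hn (by omega) hx
    _ = _ := by
        rw [← mul_pow, ← mul_pow]
        ring

lemma digraphProb_memF_le {n : ℕ} {p q : ℝ} (hp : p ∈ Set.Icc (0 : ℝ) 1)
    (hq : q ∈ Set.Icc (0 : ℝ) 1) (k : ℕ) :
    digraphProb n p q {E | memF n k E} ≤
      2 * digraphProb n p q {E | IsLeftObstruction n k E} := by
  refine (digraphProb_mono hp hq (fun E hE => memF.isLeftObstruction hE)).trans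
    ((digraphProb_union_le hp hq {E | IsLeftObstruction n k E}
      {E | IsLeftObstruction n k (E.map (Equiv.prodComm _ _).toEmbedding)}).trans_eq ?_)
  rw [two_mul]
  congr 1
  exact digraphProb_preimage_swap n p q {E | IsLeftObstruction n k E}

lemma sum_Icc_two_pow_sub_one_le {z : ℝ} (hz : 0 ≤ z) (hz' : z ≤ 1 / 2) (m : ℕ) :
    ∑ k ∈ Icc 2 m, z ^ (k - 1) ≤ 2 * z := by
  calc ∑ k ∈ Icc 2 m, z ^ (k - 1) ≤ ∑ i ∈ Ico 1 (m + 1), z ^ i := by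
        have hinj : Set.InjOn (fun k => k - 1) (Icc 2 m : Finset ℕ) := by
          intro a ha b hb hab
          simp only [coe_Icc, Set.mem_Icc] at ha hb hab
          omega
        rw [← sum_image (f := fun i => z ^ i) hinj]
        refine sum_le_sum_of_subset_of_nonneg (fun i hi => ?_) fun i _ _ => by positivity
        obtain ⟨k, hk, rfl⟩ := mem_image.1 hi
        rw [mem_Icc] at hk
        rw [mem_Ico]
        omega
    _ ≤ z ^ 1 / (1 - z) := geom_sum_Ico_le_of_lt_one hz (by linarith)
    _ ≤ 2 * z := by
        rw [div_le_iff₀ (by linarith)]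
        nlinarith

lemma sum_digraphProb_memF_le {n : ℕ} {p q B z : ℝ} (hp : p ∈ Set.Icc (0 : ℝ) 1)
    (hq : q ∈ Set.Icc (0 : ℝ) 1) (hnp : 1 ≤ n * p) (hB : 1 ≤ B)
    (hnB : n * Real.exp (-(n * p)) ≤ B)
    (hsmall : (2 * Real.exp 1 ^ 4 * B) ^ 2 * (n * p ^ 2) ≤ z)
    (hlarge : Real.exp 1 ^ 2 * ((n * p) ^ 2 * Real.exp (-(n * p / 4))) ≤ z) (hz : z ≤ 1 / 2) :
    ∑ k ∈ Icc 2 ((n + 1) / 2), digraphProb n p q {E | memF n k E} ≤ 4 * z := by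
  have hz0 : 0 ≤ z := le_trans (by positivity) hsmall
  calc ∑ k ∈ Icc 2 ((n + 1) / 2), digraphProb n p q {E | memF n k E}
      ≤ ∑ k ∈ Icc 2 ((n + 1) / 2), 2 * z ^ (k - 1) := by
        refine sum_le_sum fun k hk => (digraphProb_memF_le hp hq k).trans ?_
        rw [mem_Icc] at hk
        gcongr
        rcases le_total (k * p) 1 with h | h
        · exact (digraphProb_isLeftObstruction_le_of_small hp hq hk.1 (by omega) hnp h hB
            hnB).trans (pow_le_pow_left₀ (by have := hp.1; positivity) hsmall _)
        · calc _ ≤ _ := digraphProb_isLeftObstruction_le_of_large hp hq hk.1 hk.2 h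
            _ ≤ z ^ k := pow_le_pow_left₀ (by positivity) hlarge _
            _ ≤ z ^ (k - 1) := pow_le_pow_of_le_one hz0 (by linarith) (Nat.sub_le k 1)
    _ = 2 * ∑ k ∈ Icc 2 ((n + 1) / 2), z ^ (k - 1) := by rw [mul_sum]
    _ ≤ 4 * z := by linarith [sum_Icc_two_pow_sub_one_le hz0 hz ((n + 1) / 2)]

lemma digraphProb_not_hasHamiltonianDecomposition_sub_le {n : ℕ} (hn : 1 ≤ n) {p q : ℝ}
    (hp : p ∈ Set.Icc (0 : ℝ) 1) (hq : q ∈ Set.Icc (0 : ℝ) 1) :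
    digraphProb n p q {E | ¬ HasHamiltonianDecomposition n E} -
        digraphProb n p q {E | memF n 1 E} ≤
      ∑ k ∈ Icc 2 ((n + 1) / 2), digraphProb n p q {E | memF n k E} := by
  have h := digraphProb_le_sum hp hq (Icc 1 ((n + 1) / 2))
    (A := {E | ¬ HasHamiltonianDecomposition n E}) (B := fun k => {E | memF n k E})
    fun E hE => exists_memF_of_not_hasHamiltonianDecomposition hE
  rw [← add_sum_Ioc_eq_sum_Icc (by omega : 1 ≤ (n + 1) / 2)] at h
  rw [sub_le_iff_le_add']
  exact h

/-- If `n·p_n - log n → c` then, in the model `G(n, p_n, q_n)`, the sum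
of the probabilities of `F_k^n` for `2 ≤ k ≤ ⌈n/2⌉` tends to `0`; consequently
`P(Γ^n) - P(F_1^n) → 0`. -/
theorem sum_prob_memF_tendsto_zero (c : ℝ) (p q : ℕ → ℝ)
    (hp : ∀ n, p n ∈ Set.Icc (0 : ℝ) 1) (hq : ∀ n, q n ∈ Set.Icc (0 : ℝ) 1)
    (hlim : Tendsto (fun n : ℕ => (n : ℝ) * p n - Real.log n) atTop (nhds c)) :
    Tendsto (fun n : ℕ => ∑ k ∈ Finset.Icc 2 ((n + 1) / 2),
        digraphProb n (p n) (q n) {E | memF n k E}) atTop (nhds 0) ∧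
    Tendsto (fun n : ℕ =>
        digraphProb n (p n) (q n) {E | ¬ HasHamiltonianDecomposition n E} -
          digraphProb n (p n) (q n) {E | memF n 1 E}) atTop (nhds 0) := by
  have hL : Tendsto (fun n : ℕ => (n : ℝ) * p n) atTop atTop := by
    have hlog : Tendsto (fun n : ℕ => Real.log n) atTop atTop :=
      Real.tendsto_log_atTop.comp tendsto_natCast_atTop_atTop
    simpa using hlim.add_atTop hlog
  set B := Real.exp (-c) + 1
  have hB : 1 ≤ B := by linarith [Real.exp_pos (-c)]
  have hnB : ∀ᶠ n : ℕ in atTop, n * Real.exp (-(n * p n)) ≤ B := by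
    have h : Tendsto (fun n : ℕ => Real.exp (-(n * p n - Real.log n))) atTop
        (nhds (Real.exp (-c))) := (Real.continuous_exp.tendsto _).comp hlim.neg
    filter_upwards [h.eventually (eventually_le_nhds (by linarith : Real.exp (-c) < B)),
      eventually_gt_atTop 0] with n hn hn0
    rwa [neg_sub, sub_eq_add_neg, Real.exp_add, Real.exp_log (by exact_mod_cast hn0)] at hn
  set y : ℕ → ℝ := fun n => (2 * Real.exp 1 ^ 4 * B) ^ 2 * (n * p n ^ 2)
  set x : ℕ → ℝ := fun n => Real.exp 1 ^ 2 * ((n * p n) ^ 2 * Real.exp (-(n * p n / 4)))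
  have hy : Tendsto y atTop (nhds 0) := by
    have h1 := ((Real.tendsto_pow_mul_exp_neg_atTop_nhds_zero 2).comp hL).mul
      ((Real.continuous_exp.tendsto _).comp hlim)
    rw [zero_mul] at h1
    have h2 : Tendsto (fun n : ℕ => n * p n ^ 2) atTop (nhds 0) := by
      refine h1.congr' ?_
      filter_upwards [eventually_gt_atTop 0] with n hn
      have hn0 : (0 : ℝ) < n := by exact_mod_cast hn
      simp only [Function.comp_apply]
      rw [Real.exp_sub, Real.exp_log hn0, Real.exp_neg]
      field_simp
    simpa only [mul_zero] using h2.const_mul ((2 * Real.exp 1 ^ 4 * B) ^ 2)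
  have hx : Tendsto x atTop (nhds 0) := by
    have h1 := ((Real.tendsto_pow_mul_exp_neg_atTop_nhds_zero 2).comp
      (hL.atTop_div_const (by norm_num : (0 : ℝ) < 4))).const_mul (Real.exp 1 ^ 2 * 16)
    rw [mul_zero] at h1
    refine h1.congr fun n => ?_
    simp only [Function.comp_apply, x]
    ring
  have hsum_nonneg : ∀ n, 0 ≤ ∑ k ∈ Finset.Icc 2 ((n + 1) / 2),
      digraphProb n (p n) (q n) {E | memF n k E} := fun n =>
    sum_nonneg fun k _ => digraphProb_nonneg (hp n) (hq n) _
  have hsum : Tendsto (fun n : ℕ => ∑ k ∈ Finset.Icc 2 ((n + 1) / 2),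
      digraphProb n (p n) (q n) {E | memF n k E}) atTop (nhds 0) := by
    have hz : Tendsto (fun n => max (y n) (x n)) atTop (nhds 0) := by simpa using hy.max hx
    refine squeeze_zero' (.of_forall hsum_nonneg) ?_ (by simpa using hz.const_mul 4)
    filter_upwards [hnB, hL.eventually_ge_atTop 1,
      hz.eventually (eventually_le_nhds (by norm_num : (0 : ℝ) < 1 / 2))] with n h1 h2 h3
    exact sum_digraphProb_memF_le (hp n) (hq n) h2 hB h1 (le_max_left _ _) (le_max_right _ _) h3
  refine ⟨hsum, squeeze_zero' (.of_forall fun n => ?_) ?_ hsum⟩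
  · exact sub_nonneg.2 (digraphProb_mono (hp n) (hq n) fun E hE =>
      memF_one.not_hasHamiltonianDecomposition hE)
  · filter_upwards [eventually_ge_atTop 1] with n hn
    exact digraphProb_not_hasHamiltonianDecomposition_sub_le hn (hp n) (hq n)
end

section
/- Let (p_n) be a sequence in [0,1]. If n·p_n − log n → +∞, then the probability that a digraph drawn from the random digraph model G(n, p_n) admits a Hamiltonian decomposition tends to 1 as n → ∞; if n·p_n − log n → −∞, this probability tends to 0. -/
open Finset Filter

open Classical in
/-- The probability that a random subset of `α`, containing each element independently with
probability `p`, satisfies `A`. -/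
noncomputable def randomSubsetProb {α : Type*} [Fintype α] (p : ℝ) (A : Finset α → Prop) : ℝ :=
  ∑ E : Finset α, if A E then p ^ #E * (1 - p) ^ #Eᶜ else 0

section RandomSubset

open Classical

variable {α β ι : Type*} [Fintype α] [Fintype β] {p : ℝ}

lemma randomSubsetProb_nonneg (hp : p ∈ Set.Icc (0 : ℝ) 1) (A : Finset α → Prop) :
    0 ≤ randomSubsetProb p A := by
  have := sub_nonneg.2 hp.2
  have := hp.1
  unfold randomSubsetProb
  positivity

lemma randomSubsetProb_mono (hp : p ∈ Set.Icc (0 : ℝ) 1) {A B : Finset α → Prop}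
    (h : ∀ E, A E → B E) : randomSubsetProb p A ≤ randomSubsetProb p B := by
  have := sub_nonneg.2 hp.2
  have := hp.1
  refine sum_le_sum fun E _ => ?_
  by_cases hA : A E
  · simp [hA, h E hA]
  · rw [if_neg hA]
    positivity

lemma randomSubsetProb_or_le (hp : p ∈ Set.Icc (0 : ℝ) 1) (A B : Finset α → Prop) :
    randomSubsetProb p (fun E => A E ∨ B E) ≤ randomSubsetProb p A + randomSubsetProb p B := by
  have := sub_nonneg.2 hp.2
  have := hp.1
  unfold randomSubsetProb
  rw [← sum_add_distrib]
  refine sum_le_sum fun E _ => ?_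
  have : 0 ≤ p ^ #E * (1 - p) ^ #Eᶜ := by positivity
  by_cases hA : A E <;> by_cases hB : B E <;> simp [hA, hB, this]

lemma randomSubsetProb_exists_le (hp : p ∈ Set.Icc (0 : ℝ) 1) (s : Finset ι)
    (A : ι → Finset α → Prop) :
    randomSubsetProb p (fun E => ∃ i ∈ s, A i E) ≤ ∑ i ∈ s, randomSubsetProb p (A i) := by
  have := sub_nonneg.2 hp.2
  have := hp.1
  unfold randomSubsetProb
  rw [sum_comm]
  refine sum_le_sum fun E _ => ?_
  split_ifs with h
  · obtain ⟨i, hi, hA⟩ := h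
    have h0 : ∀ j ∈ s, (0 : ℝ) ≤ if A j E then p ^ #E * (1 - p) ^ #Eᶜ else 0 := by
      intros; positivity
    simpa [hA] using single_le_sum h0 hi
  · exact sum_nonneg fun i _ => by positivity

lemma randomSubsetProb_equiv (e : α ≃ β) (A : Finset β → Prop) :
    randomSubsetProb p (fun E : Finset α => A (E.map e.toEmbedding)) = randomSubsetProb p A := by
  unfold randomSubsetProb
  refine Fintype.sum_equiv e.finsetCongr _ _ fun E => ?_
  simp [card_compl, Fintype.card_congr e]

/-- The probability that a random subset contains `R` and avoids `Q`. -/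
lemma randomSubsetProb_cylinder {R Q : Finset α} (h : Disjoint R Q) :
    randomSubsetProb p (fun E => R ⊆ E ∧ Disjoint E Q) = p ^ #R * (1 - p) ^ #Q := by
  have key := prod_add (fun e => if e ∈ Q then 0 else p) (fun e => if e ∈ R then 0 else 1 - p)
    (univ : Finset α)
  have hl : ∏ e : α, ((if e ∈ Q then 0 else p) + if e ∈ R then 0 else 1 - p)
      = p ^ #R * (1 - p) ^ #Q := by
    have : ∀ e : α, ((if e ∈ Q then 0 else p) + if e ∈ R then 0 else 1 - p)
        = (if e ∈ R then p else 1) * (if e ∈ Q then 1 - p else 1) := by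
      intro e
      by_cases h1 : e ∈ R
      · simp [h1, Finset.disjoint_left.1 h h1]
      · by_cases h2 : e ∈ Q <;> simp [h1, h2]
    simp only [this, prod_mul_distrib, prod_ite, prod_const_one, mul_one, prod_const]
    simp
  rw [← hl, key, powerset_univ]
  refine sum_congr rfl fun E _ => ?_
  split_ifs with hE
  · rw [prod_congr rfl (g := fun _ => p), prod_congr (s₁ := univ \ E) rfl (g := fun _ => 1 - p),
      prod_const, prod_const, compl_eq_univ_sdiff]
    · intro e he
      rw [if_neg]
      intro h'
      exact (mem_sdiff.1 he).2 (hE.1 h')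
    · intro e he
      rw [if_neg (Finset.disjoint_left.1 hE.2 he)]
  · symm
    rw [not_and_or] at hE
    rcases hE with hE | hE
    · obtain ⟨e, heR, heE⟩ := Finset.not_subset.1 hE
      refine mul_eq_zero_of_right _ (prod_eq_zero (mem_sdiff.2 ⟨mem_univ e, heE⟩) ?_)
      rw [if_pos heR]
    · obtain ⟨e, heE, heQ⟩ := Finset.not_disjoint_iff.1 hE
      refine mul_eq_zero_of_left (prod_eq_zero heE ?_) _
      rw [if_pos heQ]

lemma randomSubsetProb_true : randomSubsetProb p (fun _ : Finset α => True) = 1 := by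
  simpa using randomSubsetProb_cylinder (p := p) (disjoint_empty_left (∅ : Finset α))

lemma randomSubsetProb_add_not (A : Finset α → Prop) :
    randomSubsetProb p A + randomSubsetProb p (fun E => ¬ A E) = 1 := by
  rw [← randomSubsetProb_true (α := α) (p := p)]
  unfold randomSubsetProb
  rw [← sum_add_distrib]
  refine sum_congr rfl fun E _ => ?_
  by_cases h : A E <;> simp [h]

lemma randomSubsetProb_nonempty :
    randomSubsetProb p (fun E : Finset α => E.Nonempty) = 1 - (1 - p) ^ Fintype.card α := by
  have h1 := randomSubsetProb_add_not (p := p) (fun E : Finset α => E.Nonempty)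
  have h2 := randomSubsetProb_cylinder (p := p) (disjoint_empty_left (univ : Finset α))
  have h3 : (fun E : Finset α => ∅ ⊆ E ∧ Disjoint E univ) = fun E => ¬ E.Nonempty := by
    ext E
    simp [Finset.not_nonempty_iff_eq_empty, ← Finset.top_eq_univ]
  rw [h3] at h2
  rw [h2] at h1
  simp at h1
  linarith

/-- Rows of a random subset of a product are independent. -/
lemma randomSubsetProb_forall_row_nonempty_le (hp : p ∈ Set.Icc (0 : ℝ) 1) :
    randomSubsetProb p (fun E : Finset (α × β) => ∀ u, ∃ v, (u, v) ∈ E)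
      ≤ (1 - (1 - p) ^ Fintype.card β) ^ Fintype.card α := by
  have := sub_nonneg.2 hp.2
  have := hp.1
  rw [← randomSubsetProb_nonempty (α := β), randomSubsetProb, randomSubsetProb,
    ← Finset.card_univ (α := α), ← prod_const, prod_univ_sum]
  let row : Finset (α × β) → α → Finset β := fun E u => univ.filter fun v => (u, v) ∈ E
  have hrow : Function.Injective row := by
    intro E F h
    ext ⟨u, v⟩
    have := congrArg (v ∈ ·) (congrFun h u)
    simpa [row] using this
  have hcard : ∀ E : Finset (α × β), ∑ u, #(row E u) = #E := by
    intro E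
    rw [← card_sigma]
    refine card_bij (fun x _ => (x.1, x.2)) ?_ ?_ ?_
    · rintro ⟨u, v⟩ h
      simpa [row] using h
    · rintro ⟨u, v⟩ _ ⟨u', v'⟩ _ h
      simpa using h
    · rintro ⟨u, v⟩ h
      exact ⟨⟨u, v⟩, by simpa [row] using h, rfl⟩
  have hcompl : ∀ E : Finset (α × β), ∀ u, (row E u)ᶜ = row Eᶜ u := by
    intro E u
    ext v
    simp [row]
  calc _ ≤ ∑ E : Finset (α × β), ∏ u, (if (row E u).Nonempty then
        p ^ #(row E u) * (1 - p) ^ #(row E u)ᶜ else 0) := by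
        refine sum_le_sum fun E _ => ?_
        split_ifs with h
        · have h' : ∀ u, (row E u).Nonempty := fun u => by
            obtain ⟨v, hv⟩ := h u
            exact ⟨v, by simpa [row] using hv⟩
          simp only [h', if_true, prod_mul_distrib, prod_pow_eq_pow_sum, hcompl, hcard]
          apply le_of_eq
          congr!
        · positivity
    _ = ∑ f ∈ univ.image row, ∏ u, (if (f u).Nonempty then
        p ^ #(f u) * (1 - p) ^ #(f u)ᶜ else 0) := by
        rw [sum_image fun _ _ _ _ h => hrow h]
    _ ≤ _ := by
        rw [Fintype.piFinset_univ]
        refine (sum_le_sum_of_subset_of_nonneg (subset_univ _) fun f _ _ => ?_).trans_eq ?_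
        · positivity
        · congr!

end RandomSubset

lemma digraphProb_eq_randomSubsetProb (n : ℕ) (p : ℝ) (A : Set (Finset (Fin n × Fin n))) :
    digraphProb n p p A = randomSubsetProb p (fun E => E ∈ A) := by
  classical
  unfold digraphProb randomSubsetProb
  refine sum_congr rfl fun E _ => ?_
  by_cases h : E ∈ A
  · simp only [h, Set.indicator_of_mem, ite_self, prod_const, if_true, compl_eq_univ_sdiff]
    congr!
  · simp [h]

/-- An obstruction to a Hamiltonian decomposition: a set `A` with exactly `#A - 1` out-neighbors,
at most half of the vertices, each of whose out-neighbors has two in-neighbors in `A`. -/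
def IsObstruction (n : ℕ) (E : Finset (Fin n × Fin n)) (A : Finset (Fin n)) : Prop :=
  #(leftNbhd n E A) + 1 = #A ∧ 2 * #A ≤ n + 1 ∧
    ∀ v ∈ leftNbhd n E A, ∃ a ∈ A, ∃ b ∈ A, a ≠ b ∧ (a, v) ∈ E ∧ (b, v) ∈ E

lemma mem_leftNbhd {n : ℕ} {E : Finset (Fin n × Fin n)} {I : Finset (Fin n)} {v : Fin n} :
    v ∈ leftNbhd n E I ↔ ∃ u ∈ I, (u, v) ∈ E := by
  simp [leftNbhd]

/-- The digraph with all edges reversed. -/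
def reverseEdges (n : ℕ) (E : Finset (Fin n × Fin n)) : Finset (Fin n × Fin n) :=
  E.map (Equiv.prodComm (Fin n) (Fin n)).toEmbedding

lemma mem_reverseEdges {n : ℕ} {E : Finset (Fin n × Fin n)} {u v : Fin n} :
    (u, v) ∈ reverseEdges n E ↔ (v, u) ∈ E := by
  simp [reverseEdges]

lemma reverseEdges_reverseEdges {n : ℕ} (E : Finset (Fin n × Fin n)) :
    reverseEdges n (reverseEdges n E) = E := by
  ext ⟨u, v⟩
  simp only [mem_reverseEdges]

/-- The vertices outside the neighborhood of a Hall violator form a Hall violator of the reversed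
digraph. -/
lemma card_leftNbhd_reverseEdges_compl_lt {n : ℕ} {E : Finset (Fin n × Fin n)}
    {A : Finset (Fin n)} (h : #(leftNbhd n E A) < #A) :
    #(leftNbhd n (reverseEdges n E) (leftNbhd n E A)ᶜ) < #(leftNbhd n E A)ᶜ := by
  have hsub : leftNbhd n (reverseEdges n E) (leftNbhd n E A)ᶜ ⊆ Aᶜ := by
    intro u hu
    obtain ⟨v, hv, hvu⟩ := mem_leftNbhd.1 hu
    rw [mem_reverseEdges] at hvu
    rw [mem_compl] at hv ⊢
    exact fun huA => hv (mem_leftNbhd.2 ⟨u, huA, hvu⟩)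
  have h1 := card_le_card hsub
  have h2 := card_le_univ A
  rw [card_compl] at h1 ⊢
  simp only [Fintype.card_fin] at *
  omega

lemma isObstruction_of_minimal {n : ℕ} {E : Finset (Fin n × Fin n)} {A : Finset (Fin n)}
    (h : #(leftNbhd n E A) < #A)
    (hmin : ∀ B, #(leftNbhd n E B) < #B → #A ≤ #B)
    (hmin' : ∀ B, #(leftNbhd n (reverseEdges n E) B) < #B → #A ≤ #B) :
    IsObstruction n E A := by
  have herase : ∀ a ∈ A, #A ≤ #(leftNbhd n E (A.erase a)) + 1 := by
    intro a ha
    by_contra hlt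
    have hc := card_erase_of_mem ha
    have hpos := card_pos.2 ⟨a, ha⟩
    have := hmin (A.erase a) (by omega)
    omega
  have hmono : ∀ a, leftNbhd n E (A.erase a) ⊆ leftNbhd n E A := by
    intro a v hv
    obtain ⟨u, hu, huv⟩ := mem_leftNbhd.1 hv
    exact mem_leftNbhd.2 ⟨u, mem_of_mem_erase hu, huv⟩
  obtain ⟨a₀, ha₀⟩ : A.Nonempty := card_pos.1 (by omega)
  have hcard : #(leftNbhd n E A) + 1 = #A := by
    have := herase a₀ ha₀
    have := card_le_card (hmono a₀)
    omega
  refine ⟨hcard, ?_, ?_⟩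
  · have h1 := hmin' _ (card_leftNbhd_reverseEdges_compl_lt h)
    have h2 := card_le_univ (leftNbhd n E A)
    rw [card_compl] at h1
    simp only [Fintype.card_fin] at *
    omega
  · intro v hv
    obtain ⟨a, ha, hav⟩ := mem_leftNbhd.1 hv
    by_contra! hno
    have hsub : leftNbhd n E (A.erase a) ⊆ (leftNbhd n E A).erase v := by
      intro w hw
      refine mem_erase.2 ⟨?_, hmono a hw⟩
      rintro rfl
      obtain ⟨b, hb, hbw⟩ := mem_leftNbhd.1 hw
      exact hno a ha b (mem_of_mem_erase hb) (ne_of_mem_erase hb).symm hav hbw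
    have h1 := card_le_card hsub
    rw [card_erase_of_mem hv] at h1
    have h2 := herase a ha
    have h3 := card_pos.2 ⟨v, hv⟩
    omega

lemma exists_card_leftNbhd_lt {n : ℕ} {E : Finset (Fin n × Fin n)}
    (h : ¬ HasHamiltonianDecomposition n E) : ∃ A, #(leftNbhd n E A) < #A := by
  by_contra! hall
  obtain ⟨f, hf, hfE⟩ := (all_card_le_biUnion_card_iff_exists_injective
    (fun u => univ.filter fun v : Fin n => (u, v) ∈ E)).1 (fun s => by
      refine (hall s).trans_eq (congrArg card ?_)
      ext v
      simp only [mem_leftNbhd, mem_biUnion, mem_filter, mem_univ, true_and])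
  exact h ⟨Equiv.ofBijective f (Finite.injective_iff_bijective.1 hf), fun u => by
    simpa using hfE u⟩

lemma exists_isObstruction {n : ℕ} {E : Finset (Fin n × Fin n)}
    (h : ¬ HasHamiltonianDecomposition n E) :
    (∃ A, IsObstruction n E A) ∨ ∃ A, IsObstruction n (reverseEdges n E) A := by
  obtain ⟨A₀, hA₀⟩ := exists_card_leftNbhd_lt h
  obtain ⟨A, hA, hmin⟩ := (univ.filter fun A => #(leftNbhd n E A) < #A ∨
    #(leftNbhd n (reverseEdges n E) A) < #A).exists_min_image card
    ⟨A₀, by simp [hA₀]⟩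
  simp only [mem_filter, mem_univ, true_and] at hA hmin
  rcases hA with hA | hA
  · exact Or.inl ⟨A, isObstruction_of_minimal hA (fun B hB => hmin B (Or.inl hB))
      fun B hB => hmin B (Or.inr hB)⟩
  · refine Or.inr ⟨A, isObstruction_of_minimal hA (fun B hB => hmin B (Or.inr hB))
      fun B hB => hmin B (Or.inl ?_)⟩
    rwa [reverseEdges_reverseEdges] at hB

/-- The edges joining each `v ∈ B` to the two vertices prescribed by `f v`. -/
def doubleStar {n : ℕ} (B : Finset (Fin n)) (f : Fin n → Fin n × Fin n) :
    Finset (Fin n × Fin n) :=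
  B.image (fun v => ((f v).1, v)) ∪ B.image (fun v => ((f v).2, v))

lemma mem_doubleStar {n : ℕ} {B : Finset (Fin n)} {f : Fin n → Fin n × Fin n} {u v : Fin n} :
    (u, v) ∈ doubleStar B f ↔ v ∈ B ∧ (u = (f v).1 ∨ u = (f v).2) := by
  simp only [doubleStar, mem_union, mem_image, Prod.mk.injEq]
  aesop

/-- The choices of a pair of distinct elements of `A` for each element of `B`. -/
def pairChoices {n : ℕ} (A B : Finset (Fin n)) : Finset (Fin n → Fin n × Fin n) :=
  Fintype.piFinset fun v => if v ∈ B then A.offDiag else {(v, v)}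

lemma card_pairChoices_le {n : ℕ} (A B : Finset (Fin n)) :
    #(pairChoices A B) ≤ (#A ^ 2) ^ #B := by
  have h : ∀ v : Fin n, #(if v ∈ B then A.offDiag else {(v, v)})
      = if v ∈ B then #A.offDiag else 1 := by
    intro v
    split_ifs <;> simp
  rw [pairChoices, Fintype.card_piFinset]
  simp only [h, prod_ite, prod_const, one_pow, mul_one, filter_mem_eq_inter, univ_inter]
  refine Nat.pow_le_pow_left ?_ _
  rw [offDiag_card, sq]
  exact Nat.sub_le _ _

lemma IsObstruction.exists_pairChoices {n : ℕ} {E : Finset (Fin n × Fin n)} {A : Finset (Fin n)}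
    (h : IsObstruction n E A) :
    ∃ f ∈ pairChoices A (leftNbhd n E A),
      doubleStar (leftNbhd n E A) f ⊆ E ∧ Disjoint E (A ×ˢ (leftNbhd n E A)ᶜ) := by
  have hpair : ∀ v, ∃ q : Fin n × Fin n,
      q ∈ (if v ∈ leftNbhd n E A then A.offDiag else {(v, v)}) ∧
        (v ∈ leftNbhd n E A → (q.1, v) ∈ E ∧ (q.2, v) ∈ E) := by
    intro v
    by_cases hv : v ∈ leftNbhd n E A
    · obtain ⟨a, ha, b, hb, hab, hav, hbv⟩ := h.2.2 v hv
      exact ⟨(a, b), by simp [hv, ha, hb, hab], fun _ => ⟨hav, hbv⟩⟩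
    · exact ⟨(v, v), by simp [hv], fun h => absurd h hv⟩
  choose f hf hfE using hpair
  refine ⟨f, Fintype.mem_piFinset.2 hf, ?_, ?_⟩
  · rintro ⟨u, v⟩ huv
    obtain ⟨hv, rfl | rfl⟩ := mem_doubleStar.1 huv
    · exact (hfE v hv).1
    · exact (hfE v hv).2
  · rw [Finset.disjoint_left]
    rintro ⟨u, v⟩ huv hmem
    obtain ⟨hu, hv⟩ := mem_product.1 hmem
    exact mem_compl.1 hv (mem_leftNbhd.2 ⟨u, hu, huv⟩)

lemma randomSubsetProb_doubleStar {n : ℕ} (p : ℝ) {A B : Finset (Fin n)}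
    {f : Fin n → Fin n × Fin n} (hf : f ∈ pairChoices A B) :
    randomSubsetProb p (fun E => doubleStar B f ⊆ E ∧ Disjoint E (A ×ˢ Bᶜ))
      = p ^ (2 * #B) * (1 - p) ^ (#A * (n - #B)) := by
  rw [randomSubsetProb_cylinder]
  · have hinj : ∀ g : Fin n → Fin n, #(B.image fun v => (g v, v)) = #B := fun g =>
      card_image_of_injective _ fun v w h => (Prod.mk.inj h).2
    have hdisj : Disjoint (B.image fun v => ((f v).1, v)) (B.image fun v => ((f v).2, v)) := by
      rw [Finset.disjoint_left]
      intro x hx hx'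
      obtain ⟨v, hv, rfl⟩ := mem_image.1 hx
      obtain ⟨w, -, hw⟩ := mem_image.1 hx'
      obtain ⟨h1, rfl⟩ := Prod.mk.inj hw
      have := Fintype.mem_piFinset.1 hf w
      rw [if_pos hv, mem_offDiag] at this
      exact this.2.2 h1.symm
    rw [doubleStar, card_union_of_disjoint hdisj, hinj, hinj, card_product, card_compl,
      Fintype.card_fin, two_mul]
  · rw [Finset.disjoint_left]
    rintro ⟨u, v⟩ huv hmem
    exact mem_compl.1 (mem_product.1 hmem).2 (mem_doubleStar.1 huv).1

/-- The union bound over the obstructions of each size. -/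
lemma randomSubsetProb_exists_isObstruction_le (n : ℕ) {p : ℝ} (hp : p ∈ Set.Icc (0 : ℝ) 1) :
    randomSubsetProb p (fun E => ∃ A, IsObstruction n E A) ≤
      ∑ j ∈ range ((n + 1) / 2), (n.choose (j + 1) : ℝ) * (n.choose j *
        ((((j + 1) ^ 2) ^ j) * (p ^ (2 * j) * (1 - p) ^ ((j + 1) * (n - j))))) := by
  have hp1 := sub_nonneg.2 hp.2
  have hp0 := hp.1
  have hbad : ∀ E : Finset (Fin n × Fin n), (∃ A, IsObstruction n E A) →
      ∃ j ∈ range ((n + 1) / 2), ∃ A ∈ powersetCard (j + 1) (univ : Finset (Fin n)),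
        ∃ B ∈ powersetCard j (univ : Finset (Fin n)), ∃ f ∈ pairChoices A B,
          doubleStar B f ⊆ E ∧ Disjoint E (A ×ˢ Bᶜ) := by
    rintro E ⟨A, hA⟩
    refine ⟨#(leftNbhd n E A), ?_, A, ?_, leftNbhd n E A, ?_, hA.exists_pairChoices⟩
    · have := hA.1
      have := hA.2.1
      rw [mem_range]
      omega
    · simp [mem_powersetCard, hA.1]
    · simp [mem_powersetCard]
  refine (randomSubsetProb_mono hp hbad).trans ?_
  refine (randomSubsetProb_exists_le hp _ _).trans (sum_le_sum fun j _ => ?_)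
  refine (randomSubsetProb_exists_le hp _ _).trans ?_
  refine (sum_le_card_nsmul _ _ (n.choose j * ((((j + 1) ^ 2) ^ j) *
    (p ^ (2 * j) * (1 - p) ^ ((j + 1) * (n - j))))) fun A hA => ?_).trans_eq ?_
  swap
  · simp [nsmul_eq_mul]
  refine (randomSubsetProb_exists_le hp _ _).trans ?_
  refine (sum_le_card_nsmul _ _ ((((j + 1) ^ 2) ^ j) *
    (p ^ (2 * j) * (1 - p) ^ ((j + 1) * (n - j)))) fun B hB => ?_).trans_eq ?_
  swap
  · simp [nsmul_eq_mul]
  refine (randomSubsetProb_exists_le hp _ _).trans ?_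
  have hAc := (mem_powersetCard.1 hA).2
  have hBc := (mem_powersetCard.1 hB).2
  rw [sum_congr rfl fun f hf => randomSubsetProb_doubleStar p hf, sum_const, nsmul_eq_mul,
    hAc, hBc]
  have h := card_pairChoices_le A B
  rw [hAc, hBc] at h
  have h' : (#(pairChoices A B) : ℝ) ≤ ((j + 1) ^ 2) ^ j := by exact_mod_cast h
  gcongr

lemma obstruction_term_le {n j : ℕ} (hj : 2 * j + 1 ≤ n) {p : ℝ} (hp : p ∈ Set.Icc (0 : ℝ) 1) :
    (n.choose (j + 1) : ℝ) * (n.choose j *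
        ((((j + 1) ^ 2) ^ j) * (p ^ (2 * j) * (1 - p) ^ ((j + 1) * (n - j))))) ≤
      Real.exp 1 ^ 2 * (n * Real.exp (-(n * p))) *
        (Real.exp 1 ^ 2 * (n * p) ^ 2 * Real.exp (-(n * p) / 4)) ^ j := by
  have hp1 := sub_nonneg.2 hp.2
  have hp0 := hp.1
  have hc1 : (n.choose (j + 1) : ℝ) ≤ (n : ℝ) ^ (j + 1) / (j + 1).factorial :=
    Nat.choose_le_pow_div _ _
  have hc2 : (n.choose j : ℝ) ≤ (n : ℝ) ^ j / j.factorial := Nat.choose_le_pow_div _ _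
  have hfac1 : ((j : ℝ) + 1) ^ j / (j + 1).factorial ≤ Real.exp (j + 1) := by
    refine le_trans ?_ (Real.pow_div_factorial_le_exp ((j : ℝ) + 1) (by positivity) (j + 1))
    gcongr
    · linarith [(Nat.cast_nonneg j : (0 : ℝ) ≤ j)]
    · omega
  have hfac2 : ((j : ℝ) + 1) ^ j / j.factorial ≤ Real.exp (j + 1) :=
    Real.pow_div_factorial_le_exp ((j : ℝ) + 1) (by positivity) j
  have hexp : (1 - p) ^ ((j + 1) * (n - j)) ≤
      Real.exp (-(n * p)) * Real.exp (-(n * p) / 4) ^ j := by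
    have h1 : 1 - p ≤ Real.exp (-p) := Real.one_sub_le_exp_neg p
    refine (pow_le_pow_left₀ hp1 h1 _).trans ?_
    rw [← Real.exp_nat_mul, ← Real.exp_nat_mul, ← Real.exp_add, Real.exp_le_exp]
    have hnj : j ≤ n := by omega
    push_cast [Nat.cast_sub hnj]
    have hmain : (j : ℝ) * n / 4 ≤ j * (n - j - 1) := by
      rcases Nat.eq_zero_or_pos j with rfl | hpos
      · simp
      · have h2 : (2 * (j : ℝ) + 1) ≤ n := by exact_mod_cast hj
        have h3 : (1 : ℝ) ≤ j := by exact_mod_cast hpos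
        rw [mul_div_assoc]
        gcongr
        linarith
    nlinarith [mul_le_mul_of_nonneg_left hmain hp0]
  calc _ ≤ ((n : ℝ) ^ (j + 1) / (j + 1).factorial) * (((n : ℝ) ^ j / j.factorial) *
        ((((j + 1) ^ 2) ^ j) * (p ^ (2 * j) *
          (Real.exp (-(n * p)) * Real.exp (-(n * p) / 4) ^ j)))) := by gcongr
    _ = ((((j : ℝ) + 1) ^ j / (j + 1).factorial) * (((j : ℝ) + 1) ^ j / j.factorial)) *
        (n * Real.exp (-(n * p)) * ((n * p) ^ 2 * Real.exp (-(n * p) / 4)) ^ j) := by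
        rw [← pow_mul, mul_comm 2 j, pow_mul _ j 2]
        simp only [mul_pow, ← pow_mul, mul_comm 2 j]
        field_simp
        ring
    _ ≤ (Real.exp (j + 1) * Real.exp (j + 1)) *
        (n * Real.exp (-(n * p)) * ((n * p) ^ 2 * Real.exp (-(n * p) / 4)) ^ j) := by gcongr
    _ = _ := by
        have h : Real.exp ((j : ℝ) + 1) = Real.exp 1 ^ (j + 1) := by
          rw [← Real.exp_nat_mul]
          push_cast
          ring_nf
        rw [h]
        ring

lemma randomSubsetProb_not_hasHamiltonianDecomposition_le (n : ℕ) {p : ℝ}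
    (hp : p ∈ Set.Icc (0 : ℝ) 1)
    (hsmall : Real.exp 1 ^ 2 * (n * p) ^ 2 * Real.exp (-(n * p) / 4) ≤ 1 / 2) :
    randomSubsetProb p (fun E => ¬ HasHamiltonianDecomposition n E) ≤
      4 * Real.exp 1 ^ 2 * (n * Real.exp (-(n * p))) := by
  have hp0 := hp.1
  have hone : randomSubsetProb p (fun E => ∃ A, IsObstruction n E A) ≤
      2 * Real.exp 1 ^ 2 * (n * Real.exp (-(n * p))) := by
    refine (randomSubsetProb_exists_isObstruction_le n hp).trans ?_
    calc _ ≤ ∑ j ∈ range ((n + 1) / 2), Real.exp 1 ^ 2 * (n * Real.exp (-(n * p))) *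
          (1 / 2 : ℝ) ^ j := by
          refine sum_le_sum fun j hj => ?_
          rw [mem_range] at hj
          refine (obstruction_term_le (by omega) hp).trans ?_
          gcongr
      _ ≤ Real.exp 1 ^ 2 * (n * Real.exp (-(n * p))) * 2 := by
          rw [← mul_sum]
          gcongr
          exact sum_geometric_two_le _
      _ = _ := by ring
  calc _ ≤ randomSubsetProb p (fun E => (∃ A, IsObstruction n E A) ∨
        ∃ A, IsObstruction n (reverseEdges n E) A) :=
        randomSubsetProb_mono hp fun E hE => exists_isObstruction hE
    _ ≤ _ := randomSubsetProb_or_le hp _ _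
    _ = randomSubsetProb p (fun E => ∃ A, IsObstruction n E A) +
        randomSubsetProb p (fun E => ∃ A, IsObstruction n E A) := by
        congr 1
        exact randomSubsetProb_equiv (Equiv.prodComm (Fin n) (Fin n))
          (fun E => ∃ A, IsObstruction n E A)
    _ ≤ _ := by linarith

lemma nat_mul_exp_neg {n : ℕ} (hn : 0 < n) (x : ℝ) :
    n * Real.exp (-x) = Real.exp (-(x - Real.log n)) := by
  rw [neg_sub, sub_eq_add_neg, Real.exp_add, Real.exp_log (by exact_mod_cast hn)]

lemma tendsto_sq_mul_exp_neg_div_four :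
    Tendsto (fun x : ℝ => Real.exp 1 ^ 2 * x ^ 2 * Real.exp (-x / 4)) atTop (nhds 0) := by
  have h := (Real.tendsto_pow_mul_exp_neg_atTop_nhds_zero 2).comp
    (tendsto_id.atTop_div_const (by norm_num : (0 : ℝ) < 4))
  have h' := h.const_mul (Real.exp 1 ^ 2 * 16)
  rw [mul_zero] at h'
  refine h'.congr fun x => ?_
  simp only [Function.comp_apply, id, neg_div]
  ring

lemma tendsto_hamiltonianDecomposition_one {p : ℕ → ℝ} (hp : ∀ n, p n ∈ Set.Icc (0 : ℝ) 1)
    (h : Tendsto (fun n : ℕ => (n : ℝ) * p n - Real.log n) atTop atTop) :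
    Tendsto (fun n : ℕ => randomSubsetProb (p n) (HasHamiltonianDecomposition n)) atTop
      (nhds 1) := by
  have hx : Tendsto (fun n : ℕ => (n : ℝ) * p n) atTop atTop := by
    refine tendsto_atTop_mono (fun n => ?_) h
    linarith [Real.log_natCast_nonneg n]
  have hsmall := (tendsto_sq_mul_exp_neg_div_four.comp hx).eventually_le_const
    (by norm_num : (0 : ℝ) < 1 / 2)
  have hbound : Tendsto (fun n : ℕ => 4 * Real.exp 1 ^ 2 *
      Real.exp (-((n : ℝ) * p n - Real.log n))) atTop (nhds 0) := by
    have := (Real.tendsto_exp_neg_atTop_nhds_zero.comp h).const_mul (4 * Real.exp 1 ^ 2)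
    rwa [mul_zero] at this
  have hnot : Tendsto (fun n : ℕ => randomSubsetProb (p n)
      (fun E => ¬ HasHamiltonianDecomposition n E)) atTop (nhds 0) := by
    refine squeeze_zero' (Eventually.of_forall fun n => randomSubsetProb_nonneg (hp n) _) ?_ hbound
    filter_upwards [hsmall, eventually_gt_atTop 0] with n hn hn0
    rw [← nat_mul_exp_neg hn0]
    exact randomSubsetProb_not_hasHamiltonianDecomposition_le n (hp n) hn
  have := hnot.const_sub 1
  rw [sub_zero] at this
  refine this.congr fun n => ?_
  linarith [randomSubsetProb_add_not (p := p n) (HasHamiltonianDecomposition n)]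

lemma randomSubsetProb_hasHamiltonianDecomposition_le (n : ℕ) {p : ℝ}
    (hp : p ∈ Set.Icc (0 : ℝ) 1) :
    randomSubsetProb p (HasHamiltonianDecomposition n) ≤ Real.exp (-(n * (1 - p) ^ n)) := by
  have h1 := randomSubsetProb_forall_row_nonempty_le (α := Fin n) (β := Fin n) hp
  rw [Fintype.card_fin] at h1
  have hle : (1 - p) ^ n ≤ 1 := pow_le_one₀ (by linarith [hp.2]) (by linarith [hp.1])
  calc _ ≤ randomSubsetProb p (fun E : Finset (Fin n × Fin n) => ∀ u, ∃ v, (u, v) ∈ E) :=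
        randomSubsetProb_mono hp fun E ⟨σ, hσ⟩ u => ⟨σ u, hσ u⟩
    _ ≤ _ := h1
    _ ≤ Real.exp (-(1 - p) ^ n) ^ n :=
        pow_le_pow_left₀ (by linarith) (Real.one_sub_le_exp_neg _) n
    _ = _ := by
        rw [← Real.exp_nat_mul]
        ring_nf

lemma exp_le_one_sub_pow (n : ℕ) {p : ℝ} (hp : p ≤ 1 / 2) :
    Real.exp (-(n * p) - 2 * (n * p ^ 2)) ≤ (1 - p) ^ n := by
  have h1 : 0 < 1 - p := by linarith
  have hlog : -p - 2 * p ^ 2 ≤ Real.log (1 - p) := by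
    refine le_trans ?_ (Real.one_sub_inv_le_log_of_pos h1)
    have : (1 - p)⁻¹ ≤ 1 + p + 2 * p ^ 2 := by
      rw [inv_le_iff_one_le_mul₀ h1]
      nlinarith [mul_nonneg (sq_nonneg p) (by linarith : 0 ≤ 1 - 2 * p)]
    linarith
  rw [← Real.exp_log h1, ← Real.exp_nat_mul, Real.exp_le_exp]
  nlinarith [mul_le_mul_of_nonneg_left hlog (Nat.cast_nonneg n : (0 : ℝ) ≤ n)]

lemma tendsto_log_sq_div_nat :
    Tendsto (fun n : ℕ => Real.log n ^ 2 / n) atTop (nhds 0) := by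
  have h := Real.tendsto_pow_log_div_mul_add_atTop 1 0 2 one_ne_zero
  simpa [Function.comp_def] using h.comp tendsto_natCast_atTop_atTop

lemma tendsto_hamiltonianDecomposition_zero {p : ℕ → ℝ} (hp : ∀ n, p n ∈ Set.Icc (0 : ℝ) 1)
    (h : Tendsto (fun n : ℕ => (n : ℝ) * p n - Real.log n) atTop atBot) :
    Tendsto (fun n : ℕ => randomSubsetProb (p n) (HasHamiltonianDecomposition n)) atTop
      (nhds 0) := by
  have hlim : Tendsto (fun n : ℕ => (n : ℝ) * (1 - p n) ^ n) atTop atTop := by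
    have h1 : Tendsto (fun n : ℕ => Real.exp (-((n : ℝ) * p n - Real.log n) + -2)) atTop atTop :=
      Real.tendsto_exp_atTop.comp
        (tendsto_atTop_add_const_right _ _ (tendsto_neg_atBot_atTop.comp h))
    refine tendsto_atTop_mono' _ ?_ h1
    filter_upwards [h.eventually_le_atBot 0, eventually_gt_atTop 3,
      tendsto_log_sq_div_nat.eventually_le_const (by norm_num : (0 : ℝ) < 1 / 4)]
      with n hn hn3 hlog
    have hn0 : (0 : ℝ) < n := by exact_mod_cast (by omega : 0 < n)
    have hn4 : (4 : ℝ) ≤ n := by exact_mod_cast hn3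
    have hp0 := (hp n).1
    have hnp : (n * p n) ^ 2 ≤ Real.log n ^ 2 := by
      have : 0 ≤ n * p n := by positivity
      gcongr
      linarith
    have hnp2 : n * p n ^ 2 ≤ 1 / 4 := by
      refine le_trans ?_ hlog
      rw [le_div_iff₀ hn0]
      linarith
    have hhalf : p n ≤ 1 / 2 := by nlinarith
    calc _ ≤ Real.exp (Real.log n + (-(n * p n) - 2 * (n * p n ^ 2))) := by
          rw [Real.exp_le_exp]
          linarith
      _ = n * Real.exp (-(n * p n) - 2 * (n * p n ^ 2)) := by
          rw [Real.exp_add, Real.exp_log hn0]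
      _ ≤ _ := by
          gcongr
          exact exp_le_one_sub_pow n hhalf
  exact squeeze_zero (fun n => randomSubsetProb_nonneg (hp n) _)
    (fun n => randomSubsetProb_hasHamiltonianDecomposition_le n (hp n))
    (Real.tendsto_exp_neg_atTop_nhds_zero.comp hlim)

/-- If `n·p_n - log n → +∞`, the probability of a Hamiltonian
decomposition under `G(n, p_n)` tends to `1`; if `n·p_n - log n → -∞`, it tends
to `0`. -/
theorem prob_hamiltonianDecomposition_dense_sparse (p : ℕ → ℝ)
    (hp : ∀ n, p n ∈ Set.Icc (0 : ℝ) 1) :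
    (Tendsto (fun n : ℕ => (n : ℝ) * p n - Real.log n) atTop atTop →
      Tendsto (fun n : ℕ =>
          digraphProb n (p n) (p n) {E | HasHamiltonianDecomposition n E}) atTop
        (nhds 1)) ∧
    (Tendsto (fun n : ℕ => (n : ℝ) * p n - Real.log n) atTop atBot →
      Tendsto (fun n : ℕ =>
          digraphProb n (p n) (p n) {E | HasHamiltonianDecomposition n E}) atTop
        (nhds 0)) := by
  simp only [digraphProb_eq_randomSubsetProb, Set.mem_ofPred_eq]
  exact ⟨tendsto_hamiltonianDecomposition_one hp, tendsto_hamiltonianDecomposition_zero hp⟩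
end
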